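/- Let u : ℝ² → ℝ be three times continuously differentiable and x₀ ∈ ℝ² a point with ∇u(x₀) ≠ 0. For each ρ > 0 let m(ρ) be any median of u on the closed Euclidean disk B̄(x₀, ρ). Then, as ρ → 0⁺, m(ρ) = u(x₀) + (ρ²/6)·κ(x₀) + o(ρ²), where κ = (u_y² u_xx − 2 u_x u_y u_xy + u_x² u_yy)/(u_x² + u_y²) is the curvature motion operator |∇u|·div(∇u/|∇u|). (Median filtering with a ρ-ball approximates a time step of size ρ²/6 of the curvature motion PDE u_t = |∇u| div(∇u/|∇u|).) -/

import Mathlib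

open MeasureTheory Asymptotics Filter Topology

noncomputable section

abbrev Plane := EuclideanSpace ℝ (Fin 2)

/-- `m` is a median of `u` on the set `A`. -/
def IsMedian (u : Plane → ℝ) (A : Set Plane) (m : ℝ) : Prop :=
  volume {x ∈ A | u x < m} ≤ volume A / 2 ∧ volume {x ∈ A | m < u x} ≤ volume A / 2

/-- partial derivative of `u` in direction `v` -/
def pd (v : Plane) (u : Plane → ℝ) (x : Plane) : ℝ := fderiv ℝ u x v

def e0 : Plane := EuclideanSpace.single 0 1
def e1 : Plane := EuclideanSpace.single 1 1

theorem exists_abs_taylor_two_remainder_le {E : Type*} [NormedAddCommGroup E] [NormedSpace ℝ E]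
    {f : E → ℝ} (hf : ContDiff ℝ 2 f) (x : E) {ε : ℝ} (hε : 0 < ε) :
    ∃ r > 0, ∀ h : E, ‖h‖ ≤ r →
      |f (x + h) - f x - fderiv ℝ f x h - fderiv ℝ (fderiv ℝ f) x h h / 2| ≤ ε * ‖h‖ ^ 2 := by
  have hd : Differentiable ℝ f := hf.differentiable (by norm_num)
  have hd2 : Differentiable ℝ (fderiv ℝ f) :=
    (hf.fderiv_right (m := 1) (by norm_num)).differentiable (by norm_num)
  have h0 := (hasFDerivAt_iff_isLittleO_nhds_zero.1 (hd2 x).hasFDerivAt).def hε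
  obtain ⟨r, hr, hball⟩ := Metric.eventually_nhds_iff.1 h0
  refine ⟨r / 2, by positivity, fun h hh => ?_⟩
  have hderiv : ∀ t : ℝ, HasDerivAt
      (fun t : ℝ => f (x + t • h) - t * fderiv ℝ f x h - t ^ 2 * (fderiv ℝ (fderiv ℝ f) x h h / 2))
      (fderiv ℝ f (x + t • h) h - fderiv ℝ f x h - t * fderiv ℝ (fderiv ℝ f) x h h) t := by
    intro t
    have hline : HasDerivAt (fun t : ℝ => x + t • h) h t := by
      simpa using ((hasDerivAt_id t).smul_const h).const_add x
    have h1 : HasDerivAt (fun t : ℝ => f (x + t • h)) (fderiv ℝ f (x + t • h) h) t :=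
      (hd (x + t • h)).hasFDerivAt.comp_hasDerivAt t hline
    have h2 := (h1.sub ((hasDerivAt_id t).mul_const (fderiv ℝ f x h))).sub
      ((hasDerivAt_pow 2 t).mul_const (fderiv ℝ (fderiv ℝ f) x h h / 2))
    refine h2.congr_deriv ?_
    norm_num
    ring
  have key := norm_image_sub_le_of_norm_deriv_le_segment_01' (C := ε * ‖h‖ ^ 2)
    (fun t _ => (hderiv t).hasDerivWithinAt) (fun t ht => by
      have hth : ‖t • h‖ ≤ ‖h‖ := by
        rw [norm_smul, Real.norm_of_nonneg ht.1]
        exact mul_le_of_le_one_left (norm_nonneg h) ht.2.le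
      have hb : ‖fderiv ℝ f (x + t • h) - fderiv ℝ f x - fderiv ℝ (fderiv ℝ f) x (t • h)‖
          ≤ ε * ‖t • h‖ := hball (by rw [dist_zero_right]; linarith)
      have := ContinuousLinearMap.le_of_opNorm_le _ hb h
      simp only [sub_apply, map_smul, smul_apply,
        smul_eq_mul] at this
      refine this.trans ?_
      have : ε * ‖t • h‖ * ‖h‖ ≤ ε * ‖h‖ * ‖h‖ := by gcongr
      linarith)
  rw [Real.norm_eq_abs] at key
  convert key using 2
  simp
  ring

/-- Truncation of `y` to the interval `[-s, s]`. -/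
def symmClamp (s y : ℝ) : ℝ := max (-s) (min s y)

theorem abs_symmClamp_le {s : ℝ} (hs : 0 ≤ s) (y : ℝ) : |symmClamp s y| ≤ |y| := by
  unfold symmClamp
  rcases le_total 0 y with h | h
  · rw [abs_of_nonneg h, abs_le]
    exact ⟨by rw [le_max_iff]; right; rw [le_min_iff]; constructor <;> linarith,
      max_le (by linarith) (min_le_right _ _)⟩
  · rw [abs_of_nonpos h, abs_le]
    exact ⟨by rw [le_max_iff]; right; rw [le_min_iff]; constructor <;> linarith,
      max_le (by linarith) ((min_le_right _ _).trans (by linarith))⟩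

theorem symmClamp_eq_self {s y : ℝ} (h : |y| ≤ s) : symmClamp s y = y := by
  rw [abs_le] at h
  rw [symmClamp, min_eq_right h.2, max_eq_right h.1]

theorem eventually_integral_symmClamp_pos {c d : ℝ} (h : 0 < c - d / 3) :
    ∀ᶠ ρ in 𝓝[>] (0 : ℝ),
      0 < ∫ b in (-1 : ℝ)..1, symmClamp (√(1 - b ^ 2)) (ρ * (c - d * b ^ 2)) := by
  have hlim : Tendsto (fun ρ : ℝ => ∫ b in (-1 : ℝ)..1,
      ρ⁻¹ * symmClamp (√(1 - b ^ 2)) (ρ * (c - d * b ^ 2))) (𝓝[>] 0)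
      (𝓝 (∫ b in (-1 : ℝ)..1, (c - d * b ^ 2))) := by
    refine intervalIntegral.tendsto_integral_filter_of_dominated_convergence
      (fun _ => |c| + |d|) ?_ ?_ (by simp) ?_
    · refine Eventually.of_forall fun ρ => Continuous.aestronglyMeasurable ?_
      unfold symmClamp
      fun_prop
    · filter_upwards [self_mem_nhdsWithin] with ρ hρ
      have hρ : 0 < ρ := hρ
      refine Eventually.of_forall fun b hb => ?_
      rw [Set.uIoc_of_le (by norm_num)] at hb
      have hb2 : b ^ 2 ≤ 1 := by nlinarith [hb.1, hb.2]
      rw [norm_mul, Real.norm_of_nonneg (inv_nonneg.2 hρ.le), Real.norm_eq_abs,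
        inv_mul_le_iff₀ hρ]
      refine (abs_symmClamp_le (Real.sqrt_nonneg _) _).trans ?_
      rw [abs_mul, abs_of_pos hρ]
      gcongr
      refine (abs_sub _ _).trans ?_
      rw [abs_mul, abs_of_nonneg (sq_nonneg b)]
      nlinarith [abs_nonneg d]
    · have : ∀ᵐ b : ℝ, b ≠ 1 := by simp [ae_iff]
      filter_upwards [this] with b hb1 hb
      rw [Set.uIoc_of_le (by norm_num)] at hb
      have hb2 : 0 < 1 - b ^ 2 := by
        have := lt_of_le_of_ne hb.2 hb1
        nlinarith [hb.1]
      have hs : 0 < √(1 - b ^ 2) := Real.sqrt_pos.2 hb2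
      have hsmall : ∀ᶠ ρ in 𝓝[>] (0 : ℝ), |ρ * (c - d * b ^ 2)| < √(1 - b ^ 2) := by
        have : Tendsto (fun ρ : ℝ => |ρ * (c - d * b ^ 2)|) (𝓝 0) (𝓝 |0 * (c - d * b ^ 2)|) :=
          Continuous.tendsto (by fun_prop) 0
        rw [zero_mul, abs_zero] at this
        exact (this.mono_left nhdsWithin_le_nhds).eventually_lt_const hs
      refine tendsto_const_nhds.congr' ?_
      filter_upwards [hsmall, self_mem_nhdsWithin] with ρ h1 h2
      have h2 : 0 < ρ := h2
      rw [symmClamp_eq_self h1.le]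
      field_simp
  have hval : ∫ b in (-1 : ℝ)..1, (c - d * b ^ 2) = 2 * (c - d / 3) := by
    rw [intervalIntegral.integral_sub (by simp) (Continuous.intervalIntegrable (by fun_prop) _ _)]
    simp
    ring
  rw [hval] at hlim
  filter_upwards [hlim.eventually_const_lt (show (0 : ℝ) < 2 * (c - d / 3) by linarith),
    self_mem_nhdsWithin] with ρ h1 h2
  have h2 : 0 < ρ := h2
  rw [intervalIntegral.integral_const_mul] at h1
  exact (mul_pos_iff_of_pos_left (inv_pos.2 h2)).1 h1

theorem eventually_half_disk_lt_volume_parabola {c d : ℝ} (h : 0 < c - d / 3) :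
    ∀ᶠ ρ in 𝓝[>] (0 : ℝ), ENNReal.ofReal (Real.pi / 2) <
      volume {z : ℝ × ℝ | z.1 ^ 2 + z.2 ^ 2 ≤ 1 ∧ z.2 < ρ * (c - d * z.1 ^ 2)} := by
  filter_upwards [eventually_integral_symmClamp_pos h] with ρ hρ
  set g : ℝ → ℝ := fun b => symmClamp (√(1 - b ^ 2)) (ρ * (c - d * b ^ 2)) with hg
  have hgc : Continuous g := by
    simp only [hg, symmClamp]
    fun_prop
  have hsc : Continuous fun b : ℝ => -√(1 - b ^ 2) := by fun_prop
  have hsub : regionBetween (fun b => -√(1 - b ^ 2)) g (Set.Ioc (-1) 1) ⊆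
      {z : ℝ × ℝ | z.1 ^ 2 + z.2 ^ 2 ≤ 1 ∧ z.2 < ρ * (c - d * z.1 ^ 2)} := by
    rintro ⟨b, a⟩ ⟨hb, ha1, ha2⟩
    simp only at hb ha1 ha2
    have ha3 : a < min (√(1 - b ^ 2)) (ρ * (c - d * b ^ 2)) :=
      (lt_max_iff.1 ha2).resolve_left (not_lt.2 ha1.le)
    rw [lt_min_iff] at ha3
    have hb2 : 0 ≤ 1 - b ^ 2 := by nlinarith [hb.1, hb.2]
    refine ⟨?_, ha3.2⟩
    have := Real.sq_sqrt hb2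
    have : a ^ 2 ≤ √(1 - b ^ 2) ^ 2 := sq_le_sq' ha1.le ha3.1.le
    simp only
    linarith
  refine lt_of_lt_of_le ?_ (measure_mono hsub)
  rw [Measure.volume_eq_prod, volume_regionBetween_eq_integral
    (hsc.integrableOn_Ioc) (hgc.integrableOn_Ioc) measurableSet_Ioc
    (fun b _ => le_max_left _ _), ← intervalIntegral.integral_of_le (by norm_num)]
  have hval : ∫ b in (-1 : ℝ)..1, (g - fun b => -√(1 - b ^ 2)) b =
      (∫ b in (-1 : ℝ)..1, g b) + Real.pi / 2 := by
    rw [← integral_sqrt_one_sub_sq, ← intervalIntegral.integral_add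
      (hgc.intervalIntegrable _ _) (Continuous.intervalIntegrable (by fun_prop) _ _)]
    simp
  rw [hval, ENNReal.ofReal_lt_ofReal_iff (by positivity)]
  linarith

theorem eventually_half_disk_lt_volume_quadratic {p A B C K : ℝ} (hp : 0 < p) (h : 0 < K - C / 6) :
    ∀ᶠ ρ in 𝓝[>] (0 : ℝ), ENNReal.ofReal (Real.pi / 2) <
      volume {z : ℝ × ℝ | z.1 ^ 2 + z.2 ^ 2 ≤ 1 ∧
        p * z.2 < ρ * (K - (A * z.2 ^ 2 + 2 * B * z.2 * z.1 + C * z.1 ^ 2) / 2)} := by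
  set δ := (K - C / 6) / 2 with hδ
  have hδ0 : 0 < δ := by positivity
  set N := |A| + |B| + 1 with hN
  have hN0 : 0 < N := by positivity
  set M := |K| + |δ| + |A| + |B| + |C| + 1 with hM
  have hM0 : 0 < M := by positivity
  have hcd : 0 < (K - δ) / p - (C / 2 / p) / 3 := by
    have : (K - δ) / p - (C / 2 / p) / 3 = δ / p := by
      rw [hδ]; field_simp; ring
    rw [this]; positivity
  have hsmall : ∀ᶠ ρ in 𝓝[>] (0 : ℝ), ρ < p * (δ / N) / M :=
    nhdsWithin_le_nhds (eventually_lt_nhds (by positivity))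
  filter_upwards [eventually_half_disk_lt_volume_parabola hcd, hsmall, self_mem_nhdsWithin]
    with ρ h1 h2 h3
  have h3 : 0 < ρ := h3
  refine h1.trans_le (measure_mono ?_)
  rintro ⟨b, a⟩ ⟨hba, ha⟩
  refine ⟨hba, ?_⟩
  simp only at hba ha ⊢
  have ha' : p * a < ρ * (K - δ - C / 2 * b ^ 2) := by
    have := mul_lt_mul_of_pos_left ha hp
    have e : p * (ρ * ((K - δ) / p - C / 2 / p * b ^ 2)) = ρ * (K - δ - C / 2 * b ^ 2) := by
      field_simp
    rwa [e] at this
  rw [lt_div_iff₀ hM0] at h2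
  have ha1 : |a| ≤ 1 := by rw [← sq_le_one_iff_abs_le_one]; nlinarith [sq_nonneg b]
  have hb1 : |b| ≤ 1 := by rw [← sq_le_one_iff_abs_le_one]; nlinarith [sq_nonneg a]
  have hquad : |A * a ^ 2 / 2 + B * a * b| ≤ |a| * N := by
    refine (abs_add_le _ _).trans ?_
    rw [abs_div, abs_mul, abs_mul, abs_mul, abs_pow, abs_two]
    have e1 : |A| * |a| ^ 2 ≤ |A| * |a| := by
      gcongr
      nlinarith [abs_nonneg a]
    have e2 : |B| * |a| * |b| ≤ |B| * |a| := mul_le_of_le_one_right (by positivity) hb1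
    have e3 : 0 ≤ |A| * |a| := by positivity
    have e4 := abs_nonneg a
    rw [hN]
    nlinarith
  have hb2 : b ^ 2 ≤ 1 := by rwa [sq_le_one_iff_abs_le_one]
  have hCb : |C / 2 * b ^ 2| ≤ |C| := by
    rw [abs_mul, abs_div, abs_two, abs_of_nonneg (sq_nonneg b)]
    nlinarith [abs_nonneg C, sq_nonneg b]
  rw [abs_le] at hquad hCb
  by_cases hη : |a| ≤ δ / N
  · have : |a| * N ≤ δ := by rwa [le_div_iff₀ hN0] at hη
    have : ρ * (K - δ - C / 2 * b ^ 2) ≤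
        ρ * (K - (A * a ^ 2 + 2 * B * a * b + C * b ^ 2) / 2) := by
      refine mul_le_mul_of_nonneg_left ?_ h3.le
      linarith
    linarith
  · push Not at hη
    rcases le_total 0 a with h0 | h0
    · exfalso
      rw [abs_of_nonneg h0] at hη
      have e1 : p * (δ / N) < p * a := by gcongr
      have e2 : ρ * (K - δ - C / 2 * b ^ 2) ≤ ρ * M := by
        gcongr
        rw [hM]
        linarith [le_abs_self K, neg_abs_le δ, abs_nonneg A, abs_nonneg B]
      linarith
    · rw [abs_of_nonpos h0] at hη
      have e1 : p * (δ / N) < p * (-a) := by gcongr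
      have e3 : |a| * N ≤ N := mul_le_of_le_one_left hN0.le ha1
      have e2 : ρ * (-M) ≤ ρ * (K - (A * a ^ 2 + 2 * B * a * b + C * b ^ 2) / 2) := by
        gcongr
        rw [hM]
        linarith [neg_abs_le K, abs_nonneg δ]
      linarith

/-- The second-order operator `|∇u| div (∇u / |∇u|)` driving curvature motion. -/
def curvatureMotion (u : Plane → ℝ) (x : Plane) : ℝ :=
  ((pd e1 u x) ^ 2 * pd e0 (pd e0 u) x
      - 2 * pd e0 u x * pd e1 u x * pd e1 (pd e0 u) x
      + (pd e0 u x) ^ 2 * pd e1 (pd e1 u) x)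
    / ((pd e0 u x) ^ 2 + (pd e1 u x) ^ 2)

theorem pd_pd {u : Plane → ℝ} {x : Plane} (hu : DifferentiableAt ℝ (fderiv ℝ u) x)
    (v w : Plane) : pd w (pd v u) x = fderiv ℝ (fderiv ℝ u) x w v := by
  unfold pd
  rw [fderiv_clm_apply hu (by fun_prop)]
  simp

theorem pd_neg (v : Plane) (u : Plane → ℝ) : pd v (-u) = -pd v u := by
  ext x
  simp [pd, fderiv_neg]

theorem curvatureMotion_neg (u : Plane → ℝ) (x : Plane) :
    curvatureMotion (-u) x = -curvatureMotion u x := by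
  simp only [curvatureMotion, pd_neg, Pi.neg_apply]
  ring

theorem clm_apply_eq_coordinates (L : Plane →L[ℝ] ℝ) (x : Plane) :
    L x = x 0 * L e0 + x 1 * L e1 := by
  have : x = x 0 • e0 + x 1 • e1 := by
    ext i
    fin_cases i <;> simp [e0, e1]
  conv_lhs => rw [this]
  simp

theorem measurePreserving_coordinates (β : OrthonormalBasis (Fin 2) ℝ Plane) :
    MeasurePreserving (fun z : ℝ × ℝ => z.1 • β 0 + z.2 • β 1) := by
  have := (β.measurePreserving_repr_symm.comp (PiLp.volume_preserving_toLp (Fin 2))).comp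
    (volume_preserving_finTwoArrow ℝ).symm
  have heq : (fun z : ℝ × ℝ => z.1 • β 0 + z.2 • β 1) =
      (β.repr.symm ∘ WithLp.toLp 2) ∘ MeasurableEquiv.finTwoArrow.symm := by
    ext1 z
    simp [← OrthonormalBasis.sum_repr_symm]
  rw [heq]
  exact this

theorem norm_sq_coordinates (β : OrthonormalBasis (Fin 2) ℝ Plane) (a b : ℝ) :
    ‖a • β 0 + b • β 1‖ ^ 2 = a ^ 2 + b ^ 2 := by
  rw [norm_add_sq_real, norm_smul, norm_smul, inner_smul_left, inner_smul_right,
    β.inner_eq_zero (by decide), β.norm_eq_one, β.norm_eq_one]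
  simp

theorem volume_half_closedBall_lt_of_coordinates (β : OrthonormalBasis (Fin 2) ℝ Plane)
    (x : Plane) {ρ : ℝ} (hρ : 0 < ρ) {T : Set (ℝ × ℝ)} {S : Set Plane} (hS : MeasurableSet S)
    (hTS : ∀ z ∈ T, x + ρ • (z.1 • β 0 + z.2 • β 1) ∈ S)
    (hT : ENNReal.ofReal (Real.pi / 2) < volume T) :
    volume (Metric.closedBall x ρ) / 2 < volume S := by
  have hpre : MeasurableSet ((fun y : Plane => x + ρ • y) ⁻¹' S) :=
    hS.preimage (by fun_prop)
  have h1 : volume T ≤ volume ((fun y : Plane => x + ρ • y) ⁻¹' S) := by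
    rw [← (measurePreserving_coordinates β).measure_preimage hpre.nullMeasurableSet]
    exact measure_mono hTS
  have h2 : volume ((fun y : Plane => x + ρ • y) ⁻¹' S) =
      ENNReal.ofReal ((ρ ^ 2)⁻¹) * volume S := by
    have : (fun y : Plane => x + ρ • y) ⁻¹' S =
        (fun y => ρ • y) ⁻¹' ((fun y => x + y) ⁻¹' S) := rfl
    rw [this, Measure.addHaar_preimage_smul _ hρ.ne', measure_preimage_add]
    simp
  have hlt := hT.trans_le (h1.trans_eq h2)
  rw [EuclideanSpace.volume_closedBall_fin_two]
  have hρ2 : 0 < ρ ^ 2 := by positivity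
  calc ENNReal.ofReal ρ ^ 2 * ENNReal.ofReal Real.pi / 2
      = ENNReal.ofReal (ρ ^ 2) * ENNReal.ofReal (Real.pi / 2) := by
        rw [mul_div_assoc, ENNReal.ofReal_pow hρ.le, ENNReal.ofReal_div_of_pos two_pos]
        simp
    _ < ENNReal.ofReal (ρ ^ 2) * (ENNReal.ofReal ((ρ ^ 2)⁻¹) * volume S) :=
        ENNReal.mul_lt_mul_right (by simpa using hρ.ne') ENNReal.ofReal_ne_top hlt
    _ = volume S := by
        rw [← mul_assoc, ← ENNReal.ofReal_mul hρ2.le, mul_inv_cancel₀ hρ2.ne']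
        simp

theorem exists_orthonormalBasis_plane {c s : ℝ} (h : c ^ 2 + s ^ 2 = 1) :
    ∃ β : OrthonormalBasis (Fin 2) ℝ Plane, β 0 = !₂[-s, c] ∧ β 1 = !₂[c, s] := by
  have ho : Orthonormal ℝ (![!₂[-s, c], !₂[c, s]] : Fin 2 → Plane) := by
    rw [orthonormal_iff_ite]
    intro i j
    fin_cases i <;> fin_cases j <;>
      simp [PiLp.inner_apply, -inner_self_eq_norm_sq_to_K] <;> linarith
  let b := basisOfOrthonormalOfCardEqFinrank ho (by simp)
  have hb : ⇑b = ![!₂[-s, c], !₂[c, s]] := coe_basisOfOrthonormalOfCardEqFinrank ho (by simp)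
  refine ⟨b.toOrthonormalBasis (by rwa [hb]), ?_, ?_⟩ <;> simp [hb]

theorem eventually_volume_half_closedBall_lt {u : Plane → ℝ} (hu : ContDiff ℝ 2 u) {x : Plane}
    (hx : fderiv ℝ u x ≠ 0) {ε : ℝ} (hε : 0 < ε) :
    ∀ᶠ ρ in 𝓝[>] (0 : ℝ), volume (Metric.closedBall x ρ) / 2 <
      volume {y ∈ Metric.closedBall x ρ | u y < u x + ρ ^ 2 * (curvatureMotion u x / 6 + ε)} := by
  have hd2 : Differentiable ℝ (fderiv ℝ u) :=
    (hu.fderiv_right (m := 1) (by norm_num)).differentiable (by norm_num)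
  have hsymm : IsSymmSndFDerivAt ℝ u x := hu.contDiffAt.isSymmSndFDerivAt (by simp)
  set D := fderiv ℝ u x with hD
  set H := fderiv ℝ (fderiv ℝ u) x with hH
  have hq : 0 < D e0 ^ 2 + D e1 ^ 2 := by
    by_contra hle
    refine hx (ContinuousLinearMap.ext fun y => ?_)
    have h0 : D e0 = 0 := by nlinarith [sq_nonneg (D e0), sq_nonneg (D e1)]
    have h1 : D e1 = 0 := by nlinarith [sq_nonneg (D e0), sq_nonneg (D e1)]
    rw [clm_apply_eq_coordinates, h0, h1]
    simp
  set p := √(D e0 ^ 2 + D e1 ^ 2) with hp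
  have hp0 : 0 < p := Real.sqrt_pos.2 hq
  have hp2 : p ^ 2 = D e0 ^ 2 + D e1 ^ 2 := Real.sq_sqrt hq.le
  obtain ⟨β, hβ0, hβ1⟩ := exists_orthonormalBasis_plane (c := D e0 / p) (s := D e1 / p)
    (by field_simp; exact hp2.symm)
  have hD0 : D (β 0) = 0 := by
    rw [clm_apply_eq_coordinates, hβ0]
    simp
    ring
  have hD1 : D (β 1) = p := by
    rw [clm_apply_eq_coordinates, hβ1]
    simp
    field_simp
    exact hp2.symm
  have hκ : H (β 0) (β 0) = curvatureMotion u x := by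
    have hflip : ∀ y, H y (β 0) = -(D e1 / p) * H y e0 + D e0 / p * H y e1 := fun y => by
      rw [clm_apply_eq_coordinates, hβ0]
      simp
    have hs : H e0 e1 = H e1 e0 := hsymm e0 e1
    have hs0 : H (β 0) e0 = H e0 (β 0) := hsymm (β 0) e0
    have hs1 : H (β 0) e1 = H e1 (β 0) := hsymm (β 0) e1
    rw [hflip, hs0, hs1, hflip, hflip]
    simp only [curvatureMotion, pd_pd hd2.differentiableAt]
    simp only [pd, ← hD, ← hH, hs, ← hp2]
    field_simp
    ring
  obtain ⟨r, hr, htaylor⟩ := exists_abs_taylor_two_remainder_le hu x (half_pos hε)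
  have hK : 0 < (curvatureMotion u x / 6 + ε / 2) - H (β 0) (β 0) / 6 := by
    rw [hκ]
    linarith
  have hρr : ∀ᶠ ρ in 𝓝[>] (0 : ℝ), ρ < r := nhdsWithin_le_nhds (eventually_lt_nhds hr)
  filter_upwards [eventually_half_disk_lt_volume_quadratic (A := H (β 1) (β 1))
    (B := (H (β 0) (β 1) + H (β 1) (β 0)) / 2) hp0 hK, hρr, self_mem_nhdsWithin] with ρ h1 h2 h3
  have h3 : 0 < ρ := h3
  refine volume_half_closedBall_lt_of_coordinates β x h3 ?_ ?_ h1
  · exact Metric.isClosed_closedBall.measurableSet.inter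
      (measurableSet_lt hu.continuous.measurable measurable_const)
  rintro ⟨b, a⟩ ⟨hba, hlt⟩
  simp only at hba hlt ⊢
  have hn := norm_sq_coordinates β b a
  set v := b • β 0 + a • β 1 with hv
  have hv1 : ‖v‖ ≤ 1 := by
    rw [← sq_le_one_iff₀ (norm_nonneg v), hn]
    exact hba
  have hρv : ‖ρ • v‖ ≤ ρ := by
    rw [norm_smul, Real.norm_of_nonneg h3.le]
    exact mul_le_of_le_one_right h3.le hv1
  refine ⟨by simpa using hρv, ?_⟩
  have ht := (abs_le.1 (htaylor (ρ • v) (hρv.trans h2.le))).2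
  have hsq : ‖ρ • v‖ ^ 2 ≤ ρ ^ 2 := by gcongr
  have hDv : D (ρ • v) = ρ * (p * a) := by
    simp only [hv, map_add, map_smul, smul_eq_mul, hD0, hD1]
    ring
  have hHv : H (ρ • v) (ρ • v) = ρ ^ 2 * (H (β 1) (β 1) * a ^ 2 +
      2 * ((H (β 0) (β 1) + H (β 1) (β 0)) / 2) * a * b + H (β 0) (β 0) * b ^ 2) := by
    simp only [hv, map_add, map_smul, add_apply, smul_apply, smul_eq_mul]
    ring
  rw [← hD, ← hH, hDv, hHv] at ht
  have hlt' := mul_lt_mul_of_pos_left hlt h3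
  have hsq' := mul_le_mul_of_nonneg_left hsq (half_pos hε).le
  change u (x + ρ • v) < _
  linarith

theorem IsMedian.le_of_half_lt {u : Plane → ℝ} {A : Set Plane} {m t : ℝ} (hm : IsMedian u A m)
    (ht : volume A / 2 < volume {x ∈ A | u x < t}) : m ≤ t := by
  by_contra! hlt
  exact (hm.1.trans_lt ht).not_ge (measure_mono fun x hx => ⟨hx.1, hx.2.trans hlt⟩)

theorem IsMedian.neg {u : Plane → ℝ} {A : Set Plane} {m : ℝ} (hm : IsMedian u A m) :
    IsMedian (-u) A (-m) := by
  simpa [IsMedian, and_comm] using hm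

/-- Median filtering with a ρ-ball approximates a time step of size ρ²/6 of
curvature motion. -/
theorem median_ball_approximates_curvature_motion
    (u : Plane → ℝ) (hu : ContDiff ℝ 3 u) (x₀ : Plane)
    (hgrad : gradient u x₀ ≠ 0)
    (m : ℝ → ℝ)
    (hm : ∀ ρ > 0, IsMedian u (Metric.closedBall x₀ ρ) (m ρ)) :
    (fun ρ : ℝ => m ρ - u x₀ - ρ ^ 2 / 6 *
        (((pd e1 u x₀) ^ 2 * pd e0 (pd e0 u) x₀
          - 2 * pd e0 u x₀ * pd e1 u x₀ * pd e1 (pd e0 u) x₀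
          + (pd e0 u x₀) ^ 2 * pd e1 (pd e1 u) x₀)
          / ((pd e0 u x₀) ^ 2 + (pd e1 u x₀) ^ 2)))
      =o[𝓝[>] 0] (fun ρ : ℝ => ρ ^ 2) := by
  change (fun ρ : ℝ => m ρ - u x₀ - ρ ^ 2 / 6 * curvatureMotion u x₀) =o[𝓝[>] 0] _
  have hu2 : ContDiff ℝ 2 u := hu.of_le (by norm_num)
  have hu2' : ContDiff ℝ 2 (-u) := hu2.neg
  have hx : fderiv ℝ u x₀ ≠ 0 := fun h => hgrad (by simp [gradient, h])
  have hx' : fderiv ℝ (-u) x₀ ≠ 0 := by rwa [fderiv_neg, neg_ne_zero]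
  refine isLittleO_iff.2 fun ε hε => ?_
  filter_upwards [eventually_volume_half_closedBall_lt hu2 hx hε,
    eventually_volume_half_closedBall_lt hu2' hx' hε, self_mem_nhdsWithin] with ρ h1 h2 h3
  have hup := (hm ρ h3).le_of_half_lt h1
  have hlow := (hm ρ h3).neg.le_of_half_lt h2
  rw [curvatureMotion_neg, Pi.neg_apply] at hlow
  rw [Real.norm_eq_abs, Real.norm_of_nonneg (sq_nonneg ρ), abs_le]
  constructor <;> linarith
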